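/- arXiv:2205.13751 — 5 statements merged into one kernel-verified Lean document; each statement's English description precedes it below -/
import Mathlib

section
/- The stuffle (harmonic, quasi-shuffle) product is commutative: for all finite lists u and v of positive integers, u * v = v * u in G. -/
/-- `G` is the free `ℤ`-module on the set of finite lists of positive integers. -/
abbrev FreeIndexModule : Type := List ℕ+ →₀ ℤ

/-- For a positive integer `i`, the `ℤ`-linear map on `G` sending each list `w` to `i :: w`. -/
noncomputable def consMapP (i : ℕ+) : FreeIndexModule →ₗ[ℤ] FreeIndexModule :=
  Finsupp.lmapDomain ℤ ℤ (List.cons i)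

/-- The stuffle (harmonic, quasi-shuffle) product of two lists of positive integers,
as an element of the free `ℤ`-module `G`:
`1 * w = w * 1 = w` and
`(i::u) * (j::v) = i·(u * (j::v)) + j·((i::u) * v) + (i+j)·(u * v)`. -/
noncomputable def stuffleWord : List ℕ+ → List ℕ+ → FreeIndexModule
  | [], w => Finsupp.single w 1
  | i :: u, [] => Finsupp.single (i :: u) 1
  | i :: u, j :: v =>
      consMapP i (stuffleWord u (j :: v)) + consMapP j (stuffleWord (i :: u) v)
        + consMapP (i + j) (stuffleWord u v)
termination_by u v => u.length + v.length

/-- The stuffle product is commutative: for all finite lists `u` and `v` of positive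
integers, `u * v = v * u` in `G`. -/
theorem stuffleWord_comm (u v : List ℕ+) :
    stuffleWord u v = stuffleWord v u := by
  induction u generalizing v with
  | nil => cases v <;> simp only [stuffleWord]
  | cons i u ihu =>
    induction v with
    | nil => simp only [stuffleWord]
    | cons j v ihv =>
      rw [stuffleWord, stuffleWord, ihu (j :: v), ihv, ihu v, add_comm i j,
        add_comm (consMapP i _)]
end

section
/- The stuffle (harmonic, quasi-shuffle) product is associative: for all elements u, v, w of G (equivalently, for all finite lists u, v, w of positive integers), (u * v) * w = u * (v * w), where * denotes the ℤ-bilinear extension of the stuffle product to G. -/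
/-- The `ℤ`-bilinear extension of the stuffle product to `G`. -/
noncomputable def stuffle : FreeIndexModule →ₗ[ℤ] FreeIndexModule →ₗ[ℤ] FreeIndexModule :=
  Finsupp.lsum ℤ fun u =>
    LinearMap.toSpanSingleton ℤ (FreeIndexModule →ₗ[ℤ] FreeIndexModule)
      (Finsupp.lsum ℤ fun v =>
        LinearMap.toSpanSingleton ℤ FreeIndexModule (stuffleWord u v))

theorem consMapP_single (i : ℕ+) (u : List ℕ+) (a : ℤ) :
    consMapP i (Finsupp.single u a) = Finsupp.single (i :: u) a := by
  simp [consMapP]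

theorem stuffle_single_single (u v : List ℕ+) :
    stuffle (Finsupp.single u 1) (Finsupp.single v 1) = stuffleWord u v := by
  simp [stuffle]

/-- Linear maps out of the free module agree as soon as they agree on lists. -/
theorem FreeIndexModule.hom_ext {M : Type*} [AddCommGroup M] {f g : FreeIndexModule →ₗ[ℤ] M}
    (h : ∀ u : List ℕ+, f (Finsupp.single u 1) = g (Finsupp.single u 1)) : f = g :=
  Finsupp.lhom_ext' fun u => LinearMap.ext_ring (h u)

theorem nil_stuffle (x : FreeIndexModule) : stuffle (Finsupp.single [] 1) x = x := by
  have h : stuffle (Finsupp.single [] 1) = LinearMap.id :=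
    FreeIndexModule.hom_ext fun v => by simp [stuffle_single_single, stuffleWord]
  simp [h]

theorem stuffle_nil (x : FreeIndexModule) : stuffle x (Finsupp.single [] 1) = x := by
  have h : stuffle.flip (Finsupp.single [] 1) = LinearMap.id :=
    FreeIndexModule.hom_ext fun u => by
      cases u <;> simp [stuffle_single_single, stuffleWord]
  exact LinearMap.congr_fun h x

/-- The defining recursion of the stuffle product, extended bilinearly. -/
theorem stuffle_consMapP_consMapP (i j : ℕ+) (x y : FreeIndexModule) :
    stuffle (consMapP i x) (consMapP j y) =
      consMapP i (stuffle x (consMapP j y)) + consMapP j (stuffle (consMapP i x) y)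
        + consMapP (i + j) (stuffle x y) := by
  have h : stuffle.compl₁₂ (consMapP i) (consMapP j) =
      (stuffle.compl₂ (consMapP j)).compr₂ (consMapP i)
        + (stuffle.comp (consMapP i)).compr₂ (consMapP j)
        + stuffle.compr₂ (consMapP (i + j)) :=
    FreeIndexModule.hom_ext fun u => FreeIndexModule.hom_ext fun v => by
      simp [consMapP_single, stuffle_single_single, stuffleWord]
  exact LinearMap.congr_fun₂ h x y

theorem stuffle_stuffle_consMapP (i j k : ℕ+) (x y z : FreeIndexModule) :
    stuffle (stuffle (consMapP i x) (consMapP j y)) (consMapP k z) =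
      consMapP i (stuffle (stuffle x (consMapP j y)) (consMapP k z))
        + consMapP j (stuffle (stuffle (consMapP i x) y) (consMapP k z))
        + consMapP k (stuffle (stuffle (consMapP i x) (consMapP j y)) z)
        + consMapP (i + j) (stuffle (stuffle x y) (consMapP k z))
        + consMapP (i + k) (stuffle (stuffle x (consMapP j y)) z)
        + consMapP (j + k) (stuffle (stuffle (consMapP i x) y) z)
        + consMapP (i + j + k) (stuffle (stuffle x y) z) := by
  simp only [stuffle_consMapP_consMapP, map_add, LinearMap.add_apply]
  abel

theorem stuffle_consMapP_stuffle (i j k : ℕ+) (x y z : FreeIndexModule) :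
    stuffle (consMapP i x) (stuffle (consMapP j y) (consMapP k z)) =
      consMapP i (stuffle x (stuffle (consMapP j y) (consMapP k z)))
        + consMapP j (stuffle (consMapP i x) (stuffle y (consMapP k z)))
        + consMapP k (stuffle (consMapP i x) (stuffle (consMapP j y) z))
        + consMapP (i + j) (stuffle x (stuffle y (consMapP k z)))
        + consMapP (i + k) (stuffle x (stuffle (consMapP j y) z))
        + consMapP (j + k) (stuffle (consMapP i x) (stuffle y z))
        + consMapP (i + j + k) (stuffle x (stuffle y z)) := by
  simp only [stuffle_consMapP_consMapP, map_add, add_assoc i j k]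
  abel

theorem stuffle_assoc_single (u v w : List ℕ+) :
    stuffle (stuffle (Finsupp.single u 1) (Finsupp.single v 1)) (Finsupp.single w 1) =
      stuffle (Finsupp.single u 1) (stuffle (Finsupp.single v 1) (Finsupp.single w 1)) := by
  induction u generalizing v w with
  | nil => simp only [nil_stuffle]
  | cons i u ihu =>
    induction v generalizing w with
    | nil => simp only [nil_stuffle, stuffle_nil]
    | cons j v ihv =>
      induction w with
      | nil => simp only [stuffle_nil]
      | cons k w ihw =>
        simp only [← consMapP_single] at ihu ihv ihw ⊢
        have hu (w : List ℕ+) := ihu (j :: v) w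
        have hw (v : List ℕ+) := ihu v (k :: w)
        have huw := ihu (j :: v) (k :: w)
        have hv := ihv (k :: w)
        simp only [← consMapP_single] at hu hw huw hv
        rw [stuffle_stuffle_consMapP, stuffle_consMapP_stuffle,
          huw, hv, ihw, hw, hu, ihv, ihu]

/-- The stuffle product is associative: for all elements `u`, `v`, `w` of `G`,
`(u * v) * w = u * (v * w)`. -/
theorem stuffle_assoc (u v w : FreeIndexModule) :
    stuffle (stuffle u v) w = stuffle u (stuffle v w) := by
  induction u using Finsupp.induction_linear with
  | zero => simp
  | add u₁ u₂ h₁ h₂ => simp only [map_add, LinearMap.add_apply, h₁, h₂]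
  | single u a =>
    induction v using Finsupp.induction_linear with
    | zero => simp
    | add v₁ v₂ h₁ h₂ => simp only [map_add, LinearMap.add_apply, h₁, h₂]
    | single v b =>
      induction w using Finsupp.induction_linear with
      | zero => simp
      | add w₁ w₂ h₁ h₂ => simp only [map_add, h₁, h₂]
      | single w c =>
        rw [← Finsupp.smul_single_one u, ← Finsupp.smul_single_one v,
          ← Finsupp.smul_single_one w]
        simp only [map_smul, LinearMap.smul_apply, stuffle_assoc_single]
end

section
/- Shuffle deconcatenation identity: let a = a_1⋯a_m and b = b_1⋯b_n be words over A and let l be an integer with 0 ≤ l ≤ m+n. Then a ⧢ b = ∑ (a_1⋯a_i ⧢ b_1⋯b_j)·(a_{i+1}⋯a_m ⧢ b_{j+1}⋯b_n), where the sum runs over all pairs (i,j) with i + j = l, 0 ≤ i ≤ min(l,m) and 0 ≤ j ≤ min(l,n), and · denotes the ℤ-bilinear extension of concatenation of words to F. -/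
/-- `F A` is the free `ℤ`-module on the set of words (finite lists) over the alphabet `A`. -/
abbrev FreeWordModule (A : Type) : Type := List A →₀ ℤ

/-- For a letter `a`, the `ℤ`-linear map on `F A` sending each word `w` to `a :: w`. -/
noncomputable def consMap {A : Type} (a : A) :
    FreeWordModule A →ₗ[ℤ] FreeWordModule A :=
  Finsupp.lmapDomain ℤ ℤ (List.cons a)

/-- The shuffle product of two words, as an element of the free `ℤ`-module `F A`:
`1 ⧢ w = w ⧢ 1 = w` and `(a::u) ⧢ (b::v) = a·(u ⧢ (b::v)) + b·((a::u) ⧢ v)`. -/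
noncomputable def shuffleWord {A : Type} : List A → List A → FreeWordModule A
  | [], w => Finsupp.single w 1
  | a :: u, [] => Finsupp.single (a :: u) 1
  | a :: u, b :: v =>
      consMap a (shuffleWord u (b :: v)) + consMap b (shuffleWord (a :: u) v)
termination_by u v => u.length + v.length

/-- The `ℤ`-bilinear extension of concatenation of words to `F A`. -/
noncomputable def concatF {A : Type} :
    FreeWordModule A →ₗ[ℤ] FreeWordModule A →ₗ[ℤ] FreeWordModule A :=
  Finsupp.lsum ℤ fun u =>
    LinearMap.toSpanSingleton ℤ (FreeWordModule A →ₗ[ℤ] FreeWordModule A)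
      (Finsupp.lsum ℤ fun v =>
        LinearMap.toSpanSingleton ℤ (FreeWordModule A) (Finsupp.single (u ++ v) 1))

open Finset in
/-- The sum of `f` over the antidiagonal of `l + 1`, when `f` splits off one step in either
coordinate. -/
theorem sum_antidiagonal_succ_of_split {M : Type*} [AddCommMonoid M] (l : ℕ)
    (f g h : ℕ → ℕ → M) (h_zero : ∀ j, f 0 (j + 1) = h 0 j) (zero_h : ∀ i, f (i + 1) 0 = g i 0)
    (h_succ : ∀ i j, f (i + 1) (j + 1) = g i (j + 1) + h (i + 1) j) :
    ∑ p ∈ antidiagonal (l + 1), f p.1 p.2 =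
      ∑ p ∈ antidiagonal l, g p.1 p.2 + ∑ p ∈ antidiagonal l, h p.1 p.2 := by
  let g' : ℕ → ℕ → M := fun i j => Nat.casesOn i 0 fun i' => g i' j
  let h' : ℕ → ℕ → M := fun i j => Nat.casesOn j 0 fun j' => h i j'
  have split : ∀ p ∈ antidiagonal (l + 1), f p.1 p.2 = g' p.1 p.2 + h' p.1 p.2 := by
    rintro ⟨i, j⟩ hp
    rw [HasAntidiagonal.mem_antidiagonal] at hp
    rcases i with _ | i <;> rcases j with _ | j
    · simp at hp
    · simp [g', h', h_zero]
    · simp [g', h', zero_h]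
    · simp [g', h', h_succ]
  rw [sum_congr rfl split, sum_add_distrib,
    Nat.sum_antidiagonal_succ (f := fun p => g' p.1 p.2),
    Nat.sum_antidiagonal_succ' (f := fun p => h' p.1 p.2)]
  simp [g', h']

section Shuffle

variable {A : Type}

theorem consMap_single (a : A) (u : List A) (c : ℤ) :
    consMap a (Finsupp.single u c) = Finsupp.single (a :: u) c := by
  simp [consMap]

theorem shuffleWord_nil_left (w : List A) : shuffleWord [] w = Finsupp.single w 1 := by
  rw [shuffleWord]

theorem shuffleWord_nil_right (w : List A) : shuffleWord w [] = Finsupp.single w 1 := by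
  cases w <;> rw [shuffleWord]

theorem shuffleWord_cons_cons (a b : A) (u v : List A) :
    shuffleWord (a :: u) (b :: v) =
      consMap a (shuffleWord u (b :: v)) + consMap b (shuffleWord (a :: u) v) := by
  rw [shuffleWord]

theorem concatF_single_single (u v : List A) :
    concatF (Finsupp.single u 1) (Finsupp.single v 1) = Finsupp.single (u ++ v) 1 := by
  simp [concatF]

theorem concatF_single_nil (x : FreeWordModule A) :
    concatF (Finsupp.single [] 1) x = x := by
  have h : concatF (Finsupp.single ([] : List A) 1) = LinearMap.id := by
    ext v : 2
    simp [concatF_single_single]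
  rw [h, LinearMap.id_apply]

theorem concatF_consMap (a : A) (x y : FreeWordModule A) :
    concatF (consMap a x) y = consMap a (concatF x y) := by
  have h : concatF ∘ₗ consMap a = (LinearMap.compRight ℤ (consMap a)) ∘ₗ concatF := by
    ext u v : 4
    simp [consMap_single, concatF_single_single]
  exact LinearMap.congr_fun (LinearMap.congr_fun h x) y

/-- The summand at `(i, j)` of the deconcatenation formula, extended by zero. -/
noncomputable def deconcatTerm (a b : List A) (i j : ℕ) : FreeWordModule A :=
  if i ≤ a.length ∧ j ≤ b.length then
    concatF (shuffleWord (a.take i) (b.take j)) (shuffleWord (a.drop i) (b.drop j))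
  else 0

theorem deconcatTerm_cons_zero (a : A) (u w : List A) (i : ℕ) :
    deconcatTerm (a :: u) w (i + 1) 0 = consMap a (deconcatTerm u w i 0) := by
  simp only [deconcatTerm, List.length_cons, Nat.add_le_add_iff_right]
  split_ifs
  · simp only [List.take_succ_cons, List.take_zero, List.drop_succ_cons, shuffleWord_nil_right,
      ← concatF_consMap, consMap_single]
  · simp

theorem deconcatTerm_zero_cons (b : A) (w v : List A) (j : ℕ) :
    deconcatTerm w (b :: v) 0 (j + 1) = consMap b (deconcatTerm w v 0 j) := by
  simp only [deconcatTerm, List.length_cons, Nat.add_le_add_iff_right]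
  split_ifs
  · simp only [List.take_succ_cons, List.take_zero, List.drop_succ_cons, shuffleWord_nil_left,
      ← concatF_consMap, consMap_single]
  · simp

theorem deconcatTerm_cons_cons (a b : A) (u v : List A) (i j : ℕ) :
    deconcatTerm (a :: u) (b :: v) (i + 1) (j + 1) =
      consMap a (deconcatTerm u (b :: v) i (j + 1)) +
        consMap b (deconcatTerm (a :: u) v (i + 1) j) := by
  simp only [deconcatTerm, List.length_cons, Nat.add_le_add_iff_right]
  split_ifs
  · simp only [List.take_succ_cons, List.drop_succ_cons, shuffleWord_cons_cons, map_add,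
      LinearMap.add_apply, concatF_consMap]
  · simp

theorem deconcatTerm_nil_left_succ (w : List A) (i j : ℕ) :
    deconcatTerm [] w (i + 1) j = 0 := by
  simp [deconcatTerm]

theorem deconcatTerm_nil_right_succ (w : List A) (i j : ℕ) :
    deconcatTerm w [] i (j + 1) = 0 := by
  simp [deconcatTerm]

theorem deconcatTerm_zero_zero (a b : List A) : deconcatTerm a b 0 0 = shuffleWord a b := by
  simp [deconcatTerm, shuffleWord_nil_left, concatF_single_nil]

theorem sum_deconcatTerm (a b : List A) (l : ℕ) (hl : l ≤ a.length + b.length) :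
    ∑ p ∈ Finset.HasAntidiagonal.antidiagonal l, deconcatTerm a b p.1 p.2 =
      shuffleWord a b := by
  induction l generalizing a b with
  | zero => simp [deconcatTerm_zero_zero]
  | succ l ih =>
    rcases a with _ | ⟨a, u⟩ <;> rcases b with _ | ⟨b, v⟩
    · simp at hl
    · rw [sum_antidiagonal_succ_of_split l _ (fun _ _ => 0)
        (fun i j => consMap b (deconcatTerm [] v i j))
        (fun j => deconcatTerm_zero_cons b [] v j)
        (fun i => deconcatTerm_nil_left_succ _ i 0)
        (fun i j => by simp [deconcatTerm_nil_left_succ]),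
        ← map_sum, ih _ _ (by simp at hl ⊢; omega)]
      simp [shuffleWord_nil_left, consMap_single]
    · rw [sum_antidiagonal_succ_of_split l _
        (fun i j => consMap a (deconcatTerm u [] i j)) (fun _ _ => 0)
        (fun j => deconcatTerm_nil_right_succ _ 0 j)
        (fun i => deconcatTerm_cons_zero a u [] i)
        (fun i j => by simp [deconcatTerm_nil_right_succ]),
        ← map_sum, ih _ _ (by simp at hl ⊢; omega)]
      simp [shuffleWord_nil_right, consMap_single]
    · simp only [List.length_cons] at hl
      rw [sum_antidiagonal_succ_of_split l _
        (fun i j => consMap a (deconcatTerm u (b :: v) i j))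
        (fun i j => consMap b (deconcatTerm (a :: u) v i j))
        (fun j => deconcatTerm_zero_cons b (a :: u) v j)
        (fun i => deconcatTerm_cons_zero a u (b :: v) i)
        (fun i j => deconcatTerm_cons_cons a b u v i j),
        ← map_sum, ← map_sum, ih _ _ (by simp only [List.length_cons]; omega),
        ih _ _ (by simp only [List.length_cons]; omega), shuffleWord_cons_cons]

end Shuffle


/-- Shuffle deconcatenation identity: for words `a = a_1⋯a_m`, `b = b_1⋯b_n` and
`0 ≤ l ≤ m + n`,
`a ⧢ b = ∑ (a_1⋯a_i ⧢ b_1⋯b_j)·(a_{i+1}⋯a_m ⧢ b_{j+1}⋯b_n)`,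
the sum running over all pairs `(i, j)` with `i + j = l`, `0 ≤ i ≤ min l m`
and `0 ≤ j ≤ min l n`, where `·` is the bilinear extension of concatenation. -/
theorem shuffleWord_deconcat (A : Type) (a b : List A) (l : ℕ)
    (hl : l ≤ a.length + b.length) :
    shuffleWord a b =
      ∑ ij ∈ (Finset.range (l + 1) ×ˢ Finset.range (l + 1)).filter
          (fun ij => ij.1 + ij.2 = l ∧ ij.1 ≤ a.length ∧ ij.2 ≤ b.length),
        concatF (shuffleWord (a.take ij.1) (b.take ij.2))
          (shuffleWord (a.drop ij.1) (b.drop ij.2)) := by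
  rw [← sum_deconcatTerm a b l hl]
  simp only [deconcatTerm]
  rw [← Finset.sum_filter]
  refine Finset.sum_congr ?_ fun _ _ => rfl
  ext ⟨i, j⟩
  simp only [Finset.mem_filter, Finset.HasAntidiagonal.mem_antidiagonal, Finset.mem_product, Finset.mem_range]
  omega
end

section
/- Let K be a field, n ≥ 1, and let j be an index with 1 ≤ j ≤ n. Suppose given vectors l_1,…,l_m ∈ K^n and, for each i with 1 ≤ i ≤ j−1, a vector p_i ∈ K^n such that p_i(i) ≠ 0 and p_i(t) = 0 for all t < i. Then the following are equivalent: (i) there exists v in the K-linear span of {l_1,…,l_m, p_1,…,p_{j−1}} with v(j) ≠ 0 and v(t) = 0 for all t < j; (ii) there exists x ∈ K^n with x(j) = 1, x(t) = 0 for all t > j, such that ∑_{t=1}^n p_i(t)·x(t) = 0 for every i with 1 ≤ i ≤ j−1, and ∑_{t=1}^n l_h(t)·x(t) ≠ 0 for some h with 1 ≤ h ≤ m. -/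
/-- Forward elimination: modulo the pivot combinations at the indices below `j`, every vector can be
made to vanish below `j`. -/
theorem exists_mem_span_pivots_eq_below {K : Type*} [Field K] {n : ℕ} {j : Fin n}
    {p : Fin n → Fin n → K}
    (hp : ∀ i : Fin n, i < j → p i i ≠ 0 ∧ ∀ t : Fin n, t < i → p i t = 0) (u : Fin n → K) :
    ∃ w ∈ Submodule.span K (p '' {i : Fin n | i < j}), ∀ t : Fin n, t < j → w t = u t := by
  suffices H : ∀ k : ℕ, ∃ w ∈ Submodule.span K (p '' {i : Fin n | i < j}),
      ∀ t : Fin n, t < j → (t : ℕ) < k → w t = u t by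
    obtain ⟨w, hw, h⟩ := H n
    exact ⟨w, hw, fun t ht => h t ht t.isLt⟩
  intro k
  induction k with
  | zero => exact ⟨0, Submodule.zero_mem _, fun t _ ht => absurd ht (Nat.not_lt_zero _)⟩
  | succ k ih =>
    obtain ⟨w, hw, h⟩ := ih
    by_cases hk : k < (j : ℕ)
    · let i : Fin n := ⟨k, hk.trans j.isLt⟩
      have hij : i < j := hk
      obtain ⟨hpi, hpt⟩ := hp i hij
      refine ⟨w + ((u i - w i) / p i i) • p i, Submodule.add_mem _ hw
        (Submodule.smul_mem _ _ (Submodule.subset_span ⟨i, hij, rfl⟩)), fun t ht htk => ?_⟩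
      rcases Nat.lt_succ_iff_lt_or_eq.mp htk with h1 | h1
      · simp [hpt t h1, h t ht h1]
      · obtain rfl : t = i := Fin.ext h1
        simp [div_mul_cancel₀ _ hpi]
    · exact ⟨w, hw, fun t ht _ => h t ht (lt_of_lt_of_le ht (not_lt.mp hk))⟩

/-- Back substitution: the homogeneous system of the pivot combinations at the indices below `j` has
a solution with leading entry `1` at `j` and zeros above `j`. -/
theorem exists_pivots_dotProduct_eq_zero {K : Type*} [Field K] {n : ℕ} {j : Fin n}
    {p : Fin n → Fin n → K}
    (hp : ∀ i : Fin n, i < j → p i i ≠ 0 ∧ ∀ t : Fin n, t < i → p i t = 0) :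
    ∃ x : Fin n → K, x j = 1 ∧ (∀ t : Fin n, j < t → x t = 0) ∧
      ∀ i : Fin n, i < j → p i ⬝ᵥ x = 0 := by
  suffices H : ∀ k : ℕ, ∃ x : Fin n → K, x j = 1 ∧ (∀ t : Fin n, j < t → x t = 0) ∧
      ∀ i : Fin n, i < j → (j : ℕ) ≤ i + k → p i ⬝ᵥ x = 0 by
    obtain ⟨x, hx, hx0, h⟩ := H j
    exact ⟨x, hx, hx0, fun i hi => h i hi (Nat.le_add_left _ _)⟩
  intro k
  induction k with
  | zero => exact ⟨Pi.single j 1, by simp, fun t ht => by simp [ht.ne'],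
      fun i hi h => absurd hi (not_lt.mpr h)⟩
  | succ k ih =>
    obtain ⟨x, hx, hx0, h⟩ := ih
    by_cases hk : k < (j : ℕ)
    · let a : Fin n := ⟨j - (k + 1), by omega⟩
      have haj : a < j := Fin.lt_def.mpr (by simp only [a]; omega)
      refine ⟨x + Pi.single a (-(p a ⬝ᵥ x) / p a a), by simp [hx, haj.ne'],
        fun t ht => by simp [hx0 t ht, (haj.trans ht).ne'], fun i hi hik => ?_⟩
      rw [dotProduct_add, dotProduct_single]
      rcases eq_or_ne i a with rfl | hia
      · rw [mul_div_cancel₀ _ (hp _ hi).1, add_neg_cancel]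
      · have hia' : (i : ℕ) ≠ j - (k + 1) := fun e => hia (Fin.ext e)
        have hai : a < i := Fin.lt_def.mpr (by simp only [a]; omega)
        rw [h i hi (by omega), (hp i hi).2 a hai, zero_mul, add_zero]
    · exact ⟨x, hx, hx0, fun i hi _ => h i hi (by omega)⟩

/-- A vector supported weakly above `j` and one supported weakly below `j` only pair at `j`. -/
theorem dotProduct_eq_mul_of_supports_meet {R : Type*} [NonUnitalNonAssocSemiring R] {n : ℕ}
    {j : Fin n} {v x : Fin n → R} (hv : ∀ t : Fin n, t < j → v t = 0)
    (hx : ∀ t : Fin n, j < t → x t = 0) : v ⬝ᵥ x = v j * x j := by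
  refine Finset.sum_eq_single j (fun t _ ht => ?_) (by simp)
  rcases lt_or_gt_of_ne ht with h | h
  · rw [hv t h, zero_mul]
  · rw [hx t h, mul_zero]

/-- A vector orthogonal to a set is orthogonal to its span. -/
theorem dotProduct_eq_zero_of_mem_span {ι R : Type*} [Fintype ι] [CommSemiring R]
    {s : Set (ι → R)} {x v : ι → R} (hs : ∀ u ∈ s, u ⬝ᵥ x = 0)
    (hv : v ∈ Submodule.span R s) : v ⬝ᵥ x = 0 := by
  induction hv using Submodule.span_induction with
  | mem u hu => exact hs u hu
  | zero => exact zero_dotProduct x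
  | add u w _ _ hu hw => rw [add_dotProduct, hu, hw, add_zero]
  | smul c u _ hu => rw [smul_dotProduct, hu, smul_zero]

/-- Proposition A.1 (correctness of the conflict-search procedure).  Let `K` be a
field, `n ≥ 1`, `j` an index, `l_1, …, l_m ∈ K^n`, and for each `i < j` let
`p i ∈ K^n` be a pivot combination at `i` (i.e. `p i i ≠ 0` and `p i t = 0` for
`t < i`).  Then the following are equivalent:
(i) some `v` in the `K`-span of `{l_1, …, l_m, p_1, …, p_{j-1}}` satisfies
`v j ≠ 0` and `v t = 0` for all `t < j`;
(ii) there is `x ∈ K^n` with `x j = 1`, `x t = 0` for `t > j`, such that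
`∑ t, p i t · x t = 0` for every `i < j` and `∑ t, l h t · x t ≠ 0` for some `h`. -/
theorem conflict_search_correct (K : Type*) [Field K] (n m : ℕ) (hn : 1 ≤ n)
    (l : Fin m → Fin n → K) (j : Fin n) (p : Fin n → Fin n → K)
    (hp : ∀ i : Fin n, i < j → p i i ≠ 0 ∧ ∀ t : Fin n, t < i → p i t = 0) :
    (∃ v ∈ Submodule.span K (Set.range l ∪ p '' {i : Fin n | i < j}),
        v j ≠ 0 ∧ ∀ t : Fin n, t < j → v t = 0)
      ↔
    (∃ x : Fin n → K, x j = 1 ∧ (∀ t : Fin n, j < t → x t = 0) ∧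
        (∀ i : Fin n, i < j → ∑ t, p i t * x t = 0) ∧
        ∃ h : Fin m, ∑ t, l h t * x t ≠ 0) := by
  constructor
  · rintro ⟨v, hv, hvj, hv0⟩
    obtain ⟨x, hx, hx0, hpx⟩ := exists_pivots_dotProduct_eq_zero hp
    refine ⟨x, hx, hx0, hpx, ?_⟩
    by_contra! hl
    refine hvj ?_
    rw [← mul_one (v j), ← hx, ← dotProduct_eq_mul_of_supports_meet hv0 hx0]
    refine dotProduct_eq_zero_of_mem_span ?_ hv
    rintro _ (⟨h, rfl⟩ | ⟨i, hi, rfl⟩)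
    · exact hl h
    · exact hpx i hi
  · rintro ⟨x, hx, hx0, hpx, h, hlx⟩
    obtain ⟨w, hw, hwl⟩ := exists_mem_span_pivots_eq_below hp (l h)
    have hv0 : ∀ t : Fin n, t < j → (l h - w) t = 0 := fun t ht => by simp [hwl t ht]
    refine ⟨l h - w, Submodule.sub_mem _ (Submodule.subset_span (Or.inl ⟨h, rfl⟩))
      (Submodule.span_mono Set.subset_union_right hw), fun hvj => hlx ?_, hv0⟩
    have hwx : w ⬝ᵥ x = 0 := dotProduct_eq_zero_of_mem_span (by
      rintro _ ⟨i, hi, rfl⟩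
      exact hpx i hi) hw
    have hvx := dotProduct_eq_mul_of_supports_meet hv0 hx0
    rwa [hvj, zero_mul, sub_dotProduct, hwx, sub_zero] at hvx
end

section
/- Let K be a field, n ≥ 1, and let i ≤ j ≤ n be indices. For each t with i ≤ t ≤ j−1, let p_t ∈ K^n satisfy p_t(t) ≠ 0 and p_t(s) = 0 for all s < t. Let x ∈ K^n satisfy x(j) = 1, x(s) = 0 for all s > j, and ∑_{s=1}^n p_t(s)·x(s) = 0 for every t with i ≤ t ≤ j−1. If q ∈ K^n satisfies q(s) = 0 for all s < i and ∑_{s=1}^n q(s)·x(s) ≠ 0, then there exists a vector v ∈ q + span_K{p_i,…,p_{j−1}} such that v(s) = 0 for all s < j and v(j) ≠ 0. -/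
/-- Eliminating `q` against pivot vectors at the indices in `[i, j)` clears all coordinates
below `j`. -/
theorem exists_sub_mem_span_forall_lt_eq_zero {K : Type*} [Field K] {n : ℕ}
    {i j : Fin n} (hij : i ≤ j) {p : Fin n → Fin n → K}
    (hp : ∀ t : Fin n, i ≤ t → t < j → p t t ≠ 0 ∧ ∀ s : Fin n, s < t → p t s = 0)
    {q : Fin n → K} (hq : ∀ s : Fin n, s < i → q s = 0) :
    ∃ v : Fin n → K,
      v - q ∈ Submodule.span K (p '' {t : Fin n | i ≤ t ∧ t < j}) ∧
      ∀ s : Fin n, s < j → v s = 0 := by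
  suffices h : ∀ m : ℕ, i.val ≤ m → m ≤ j.val → ∃ v : Fin n → K,
      v - q ∈ Submodule.span K (p '' {t : Fin n | i ≤ t ∧ t < j}) ∧
      ∀ s : Fin n, s.val < m → v s = 0 from h j hij le_rfl
  intro m him
  induction m, him using Nat.le_induction with
  | base => exact fun _ => ⟨q, by simp, hq⟩
  | succ m him ih =>
    intro hmj
    obtain ⟨v, hv, hv0⟩ := ih (by omega)
    let t : Fin n := ⟨m, by omega⟩
    have hit : i ≤ t := him
    have htj : t < j := hmj
    obtain ⟨hpt, hpt0⟩ := hp t hit htj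
    refine ⟨v - (v t / p t t) • p t, ?_, fun s hs => ?_⟩
    · rw [sub_right_comm]
      exact sub_mem hv (Submodule.smul_mem _ _ (Submodule.subset_span ⟨t, ⟨hit, htj⟩, rfl⟩))
    · rcases Nat.lt_succ_iff_lt_or_eq.mp hs with h | h
      · simp [hv0 s h, hpt0 s h]
      · obtain rfl : s = t := Fin.ext h
        simp [hpt]

/-- Correctness of the elimination procedure (Process A.2).  Let `K` be a field,
`n ≥ 1`, and `i ≤ j` indices.  For `i ≤ t < j` let `p t ∈ K^n` be a pivot
combination at `t` (i.e. `p t t ≠ 0` and `p t s = 0` for `s < t`).  Let `x ∈ K^n`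
satisfy `x j = 1`, `x s = 0` for `s > j`, and `∑ s, p t s · x s = 0` for every
`i ≤ t < j`.  If `q ∈ K^n` satisfies `q s = 0` for all `s < i` and
`∑ s, q s · x s ≠ 0`, then there exists `v ∈ q + span_K {p_i, …, p_{j-1}}` with
`v s = 0` for all `s < j` and `v j ≠ 0`. -/
theorem elimination_correct (K : Type*) [Field K] (n : ℕ) (hn : 1 ≤ n)
    (i j : Fin n) (hij : i ≤ j) (p : Fin n → Fin n → K)
    (hp : ∀ t : Fin n, i ≤ t → t < j → p t t ≠ 0 ∧ ∀ s : Fin n, s < t → p t s = 0)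
    (x : Fin n → K) (hxj : x j = 1) (hx : ∀ s : Fin n, j < s → x s = 0)
    (hpx : ∀ t : Fin n, i ≤ t → t < j → ∑ s, p t s * x s = 0)
    (q : Fin n → K) (hq : ∀ s : Fin n, s < i → q s = 0)
    (hqx : ∑ s, q s * x s ≠ 0) :
    ∃ v : Fin n → K,
      v - q ∈ Submodule.span K (p '' {t : Fin n | i ≤ t ∧ t < j}) ∧
      (∀ s : Fin n, s < j → v s = 0) ∧ v j ≠ 0 := by
  obtain ⟨v, hv, hv0⟩ := exists_sub_mem_span_forall_lt_eq_zero hij hp hq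
  refine ⟨v, hv, hv0, fun hvj => hqx ?_⟩
  have hspan : Submodule.span K (p '' {t : Fin n | i ≤ t ∧ t < j}) ≤
      LinearMap.ker ((dotProductBilin K K).flip x) := by
    rw [Submodule.span_le]
    rintro _ ⟨t, ⟨hit, htj⟩, rfl⟩
    exact hpx t hit htj
  have hsub : (v - q) ⬝ᵥ x = 0 := hspan hv
  have hvx : v ⬝ᵥ x = 0 := by
    refine Finset.sum_eq_zero fun s _ => ?_
    rcases lt_trichotomy s j with h | rfl | h
    · simp [hv0 s h]
    · simp [hvj]
    · simp [hx s h]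
  rwa [sub_dotProduct, hvx, zero_sub, neg_eq_zero] at hsub
end
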